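/- arXiv:1605.03744 — 8 statements merged into one kernel-verified Lean document; each statement's English description precedes it below -/
import Mathlib

section
/- Let G be a finite group and G₀ ≤ G a subgroup such that (G, G₀) is an admissible pair. Then for all irreducible finite-dimensional complex representations τ_i, τ_j, τ_k of G₀ and every g ∈ G₀, χ_{Ind_{G₀}^G (τ_i ⊗ τ_j)}(g) · χ_{τ_k}(g) = χ_{τ_i}(g) · χ_{Ind_{G₀}^G (τ_j ⊗ τ_k)}(g). -/
variable {G : Type} [Group G] (G₀ : Subgroup G)

/-- The carrier of the induced representation: `G₀`-equivariant functions `G → V`. -/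
def indCarrier {V : Type*} [AddCommGroup V] [Module ℂ V]
    (τ : Representation ℂ G₀ V) : Submodule ℂ (G → V) where
  carrier := {f | ∀ (h : G₀) (x : G), f (↑h * x) = τ h (f x)}
  add_mem' := by
    intro f g hf hg h x
    simp only [Pi.add_apply, hf h x, hg h x, map_add]
  zero_mem' := by
    intro h x
    simp
  smul_mem' := by
    intro c f hf h x
    simp only [Pi.smul_apply, hf h x, map_smul]

/-- The representation of `G` induced by a representation `τ` of the subgroup `G₀`. -/
def indRep {V : Type*} [AddCommGroup V] [Module ℂ V]
    (τ : Representation ℂ G₀ V) : Representation ℂ G (indCarrier G₀ τ) where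
  toFun g :=
    { toFun := fun f => ⟨fun x => (f : G → V) (x * g), by
        intro h x
        simp only
        rw [mul_assoc]
        exact f.2 h (x * g)⟩
      map_add' := by intro f₁ f₂; apply Subtype.ext; funext x; rfl
      map_smul' := by intro c f; apply Subtype.ext; funext x; rfl }
  map_one' := by
    apply LinearMap.ext
    intro f
    apply Subtype.ext
    funext x
    simp
  map_mul' := by
    intro g₁ g₂
    apply LinearMap.ext
    intro f
    apply Subtype.ext
    funext x
    simp [mul_assoc]

/-- The character of the induced representation. -/
noncomputable def indChar [Fintype G] {V : Type*} [AddCommGroup V] [Module ℂ V]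
    [FiniteDimensional ℂ V] (τ : Representation ℂ G₀ V) (g : G) : ℂ :=
  LinearMap.trace ℂ (indCarrier G₀ τ) (indRep G₀ τ g)

/-- The pair `(G, G₀)` is *admissible* if for every irreducible finite-dimensional complex
representation `τ` of `G₀`, every `g ∈ G₀` and every `s ∈ X(g) = {s : s g s⁻¹ ∈ G₀}`, the
character of `τ` satisfies `χ_τ(s g s⁻¹) = χ_τ(g)`. -/
def IsAdmissiblePair (G : Type) [Group G] (G₀ : Subgroup G) : Prop :=
  ∀ (τ : FDRep ℂ G₀), CategoryTheory.Simple τ →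
    ∀ (g s : G) (hg : g ∈ G₀) (hs : s * g * s⁻¹ ∈ G₀),
      τ.character ⟨s * g * s⁻¹, hs⟩ = τ.character ⟨g, hg⟩

/-- Averaging over `G₀` projects the functions `G → V` onto the equivariant ones. -/
noncomputable def indProj [Finite G] {V : Type*} [AddCommGroup V] [Module ℂ V]
    (τ : Representation ℂ G₀ V) : (G → V) →ₗ[ℂ] indCarrier G₀ τ :=
  haveI := Fintype.ofFinite G₀
  LinearMap.codRestrict (indCarrier G₀ τ)
    ((Fintype.card G₀ : ℂ)⁻¹ • ∑ h : G₀, LinearMap.pi fun x : G =>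
      τ h⁻¹ ∘ₗ LinearMap.proj (h * x)) <| by
    intro f k x
    simp only [LinearMap.smul_apply, LinearMap.sum_apply, Pi.smul_apply, Finset.sum_apply,
      LinearMap.pi_apply, LinearMap.comp_apply, LinearMap.proj_apply, map_smul, map_sum]
    congr 1
    refine Fintype.sum_equiv (Equiv.mulRight k) _ _ fun h => ?_
    rw [← Module.End.mul_apply, ← map_mul]
    simp [mul_assoc]

theorem indProj_apply [Finite G] [hG₀ : Fintype G₀] {V : Type*} [AddCommGroup V] [Module ℂ V]
    (τ : Representation ℂ G₀ V) (f : G → V) (x : G) :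
    (indProj G₀ τ f : G → V) x = (Fintype.card G₀ : ℂ)⁻¹ • ∑ h : G₀, τ h⁻¹ (f (h * x)) := by
  obtain rfl := Subsingleton.elim hG₀ (Fintype.ofFinite G₀)
  let := Fintype.ofFinite G₀
  change ((Fintype.card G₀ : ℂ)⁻¹ • ∑ h : G₀, LinearMap.pi fun x : G =>
    τ h⁻¹ ∘ₗ LinearMap.proj (R := ℂ) (φ := fun _ : G => V) (h * x)) f x = _
  simp

theorem indProj_comp_subtype [Finite G] {V : Type*} [AddCommGroup V] [Module ℂ V]
    (τ : Representation ℂ G₀ V) : indProj G₀ τ ∘ₗ (indCarrier G₀ τ).subtype = LinearMap.id := by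
  have := Fintype.ofFinite G₀
  ext f x
  have hf : ∀ h : G₀, τ h⁻¹ ((f : G → V) (h * x)) = (f : G → V) x := fun h => by
    rw [f.2 h x, ← Module.End.mul_apply, ← map_mul]
    simp
  rw [LinearMap.comp_apply, indProj_apply]
  simp only [Submodule.subtype_apply, hf, LinearMap.id_apply, Finset.sum_const, Finset.card_univ]
  rw [← Nat.cast_smul_eq_nsmul ℂ, smul_smul, inv_mul_cancel₀ (by simp), one_smul]

/-- The trace of an endomorphism of a finite power is the sum of the traces of its diagonal
blocks. -/
theorem trace_pi_eq_sum {ι K V : Type*} [Fintype ι] [DecidableEq ι] [Field K] [AddCommGroup V]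
    [Module K V] [FiniteDimensional K V] (T : (ι → V) →ₗ[K] (ι → V)) :
    LinearMap.trace K (ι → V) T =
      ∑ i, LinearMap.trace K V (LinearMap.proj i ∘ₗ T ∘ₗ LinearMap.single K (fun _ => V) i) := by
  have hT : T = ∑ i, (T ∘ₗ LinearMap.single K (fun _ => V) i) ∘ₗ LinearMap.proj i := by
    apply LinearMap.ext
    intro f
    simp only [LinearMap.sum_apply, LinearMap.comp_apply, ← map_sum, LinearMap.proj_apply,
      LinearMap.coe_single, Finset.univ_sum_single]
  conv_lhs => rw [hT, map_sum]
  exact Finset.sum_congr rfl fun i _ => LinearMap.trace_comp_comm' _ _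

open Classical in
/-- Frobenius' formula for the character of an induced representation. -/
theorem indChar_eq_sum [Fintype G] {V : Type*} [AddCommGroup V] [Module ℂ V]
    [FiniteDimensional ℂ V] (τ : Representation ℂ G₀ V) (g : G) :
    indChar G₀ τ g = (Fintype.card G₀ : ℂ)⁻¹ *
      ∑ s : G, if hs : s * g * s⁻¹ ∈ G₀ then τ.character ⟨s * g * s⁻¹, hs⟩ else 0 := by
  have key : indChar G₀ τ g = LinearMap.trace ℂ (G → V)
      (((indCarrier G₀ τ).subtype ∘ₗ indRep G₀ τ g) ∘ₗ indProj G₀ τ) := by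
    rw [LinearMap.trace_comp_comm', ← LinearMap.comp_assoc, indProj_comp_subtype,
      LinearMap.id_comp]
    rfl
  rw [key, trace_pi_eq_sum, Finset.mul_sum]
  refine Finset.sum_congr rfl fun s _ => ?_
  have happ : ∀ v : V, (LinearMap.proj s ∘ₗ
      (((indCarrier G₀ τ).subtype ∘ₗ indRep G₀ τ g) ∘ₗ indProj G₀ τ) ∘ₗ
        LinearMap.single ℂ (fun _ => V) s) v =
      (Fintype.card G₀ : ℂ)⁻¹ • ∑ h : G₀, τ h⁻¹ ((Pi.single s v : G → V) (h * (s * g))) :=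
    fun v => indProj_apply G₀ τ _ _
  have hiff : ∀ h : G₀, (h : G) * (s * g) = s ↔ ((h⁻¹ : G₀) : G) = s * g * s⁻¹ := fun h => by
    rw [Subgroup.coe_inv, ← eq_mul_inv_iff_mul_eq, inv_eq_iff_eq_inv]
    simp [mul_assoc]
  split_ifs with hs
  · rw [Representation.character, ← smul_eq_mul, ← map_smul]
    congr 1
    apply LinearMap.ext
    intro v
    rw [happ, Finset.sum_eq_single (⟨s * g * s⁻¹, hs⟩ : G₀)⁻¹]
    · rw [(hiff _).2 (by simp)]
      simp
    · intro h _ hne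
      rw [Pi.single_eq_of_ne, map_zero]
      exact fun h' => hne (inv_eq_iff_eq_inv.1 (Subtype.ext ((hiff h).1 h')))
    · simp
  · rw [mul_zero, ← map_zero (LinearMap.trace ℂ V)]
    congr 1
    apply LinearMap.ext
    intro v
    rw [happ, Finset.sum_eq_zero, smul_zero, LinearMap.zero_apply]
    intro h _
    rw [Pi.single_eq_of_ne, map_zero]
    exact fun h' => hs ((hiff h).1 h' ▸ (h⁻¹).2)

open CategoryTheory MonoidalCategory Classical in
theorem indChar_tensor_of_isAdmissiblePair [Fintype G] (hadm : IsAdmissiblePair G G₀)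
    (τ σ : FDRep ℂ G₀) [Simple τ] [Simple σ] (g : G) (hg : g ∈ G₀) :
    indChar G₀ (τ ⊗ σ).ρ g = (Fintype.card G₀ : ℂ)⁻¹ *
      ((Finset.univ.filter fun s : G => s * g * s⁻¹ ∈ G₀).card *
        (τ.character ⟨g, hg⟩ * σ.character ⟨g, hg⟩)) := by
  rw [indChar_eq_sum, ← nsmul_eq_mul, ← Finset.sum_const, Finset.sum_filter]
  congr 1
  refine Finset.sum_congr rfl fun s _ => ?_
  split_ifs with hs
  · rw [← hadm τ inferInstance g s hg hs, ← hadm σ inferInstance g s hg hs]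
    exact congrFun (FDRep.char_tensor τ σ) _
  · rfl

open CategoryTheory MonoidalCategory in
/-- If `(G, G₀)` is an admissible pair, then for all irreducible finite-dimensional complex
representations `τᵢ, τⱼ, τₖ` of `G₀` and every `g ∈ G₀`,
`χ_{Ind_{G₀}^G (τᵢ ⊗ τⱼ)}(g) · χ_{τₖ}(g) = χ_{τᵢ}(g) · χ_{Ind_{G₀}^G (τⱼ ⊗ τₖ)}(g)`. -/
theorem admissible_assoc [Fintype G] (hadm : IsAdmissiblePair G G₀)
    (τi τj τk : FDRep ℂ G₀) [Simple τi] [Simple τj] [Simple τk]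
    (g : G) (hg : g ∈ G₀) :
    indChar G₀ (τi ⊗ τj).ρ g * τk.character ⟨g, hg⟩ =
      τi.character ⟨g, hg⟩ * indChar G₀ (τj ⊗ τk).ρ g := by
  rw [indChar_tensor_of_isAdmissiblePair G₀ hadm τi τj g hg,
    indChar_tensor_of_isAdmissiblePair G₀ hadm τj τk g hg]
  ring
end

section
/- Let G be a finite group and G₀ ≤ G a subgroup. If for every irreducible finite-dimensional complex representation τ of G₀ there exists a finite-dimensional complex representation τ̃ of G whose restriction to G₀ is isomorphic to τ, then (G, G₀) is an admissible pair. -/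
open CategoryTheory in
/-- If every irreducible finite-dimensional complex representation `τ` of `G₀` extends to `G`,
i.e. there is a finite-dimensional representation `τ̃` of `G` with `Res_{G₀}^G τ̃ ≅ τ`, then
`(G, G₀)` is an admissible pair. -/
theorem isAdmissiblePair_of_extends {G : Type} [Group G] [Finite G] (G₀ : Subgroup G)
    (h : ∀ (τ : FDRep ℂ G₀), Simple τ →
      ∃ τ' : FDRep ℂ G, Nonempty (FDRep.of (τ'.ρ.comp G₀.subtype) ≅ τ)) :
    IsAdmissiblePair G G₀ := by
  intro τ hτ g s hg hs
  obtain ⟨τ', ⟨e⟩⟩ := h τ hτ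
  rw [← FDRep.char_iso e]
  exact τ'.char_conj g s
end

section
/- Let H and G₀ be finite groups, φ : G₀ → Aut(H) a group action, and G = H ⋊_φ G₀ the semidirect product, with G₀ identified with the subgroup {(1, g) : g ∈ G₀} of G via the canonical inclusion. Then (G, G₀) is an admissible pair. -/
/-- For finite groups `H` and `G₀` and an action `φ : G₀ →* Aut H`, the semidirect product
`G = H ⋊[φ] G₀` together with its subgroup `{(1, g) : g ∈ G₀}` (the image of the canonical
inclusion of `G₀`) forms an admissible pair. -/
theorem isAdmissiblePair_semidirectProduct {H G₀ : Type} [Group H] [Finite H]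
    [Group G₀] [Finite G₀] (φ : G₀ →* MulAut H) :
    IsAdmissiblePair (H ⋊[φ] G₀) (SemidirectProduct.inr : G₀ →* H ⋊[φ] G₀).range := by
  rintro τ - g s ⟨a, rfl⟩ ⟨b, hb⟩
  have hb' : b = s.right * a * s.right⁻¹ := by
    simpa using congrArg SemidirectProduct.right hb
  have key := τ.char_conj ⟨SemidirectProduct.inr a, a, rfl⟩
    ⟨SemidirectProduct.inr s.right, s.right, rfl⟩
  rw [← key]
  congr 1
  apply Subtype.ext
  simp [← hb, hb']
end

section
/- Let α be a type with decidable equality, x ∈ α, and let g, s be permutations of α. If g(x) = x and (s·g·s⁻¹)(x) = x, then the permutation t := s · (swap of s⁻¹(x) and x) satisfies t(x) = x and t·g·t⁻¹ = s·g·s⁻¹. In particular, there exists a permutation t fixing x with t·g·t⁻¹ = s·g·s⁻¹. -/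
/-- Let `g, s` be permutations of `α` with `g x = x` and `(s g s⁻¹) x = x`. Then
`t := s * swap (s⁻¹ x) x` fixes `x` and satisfies `t g t⁻¹ = s g s⁻¹`; in particular there
exists a permutation `t` fixing `x` with `t g t⁻¹ = s g s⁻¹`. -/
theorem perm_conj_by_stabilizing_element {α : Type*} [DecidableEq α] (x : α)
    (g s : Equiv.Perm α) (hg : g x = x) (hs : (s * g * s⁻¹) x = x) :
    (s * Equiv.swap (s⁻¹ x) x) x = x ∧
      (s * Equiv.swap (s⁻¹ x) x) * g * (s * Equiv.swap (s⁻¹ x) x)⁻¹ = s * g * s⁻¹ ∧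
      ∃ t : Equiv.Perm α, t x = x ∧ t * g * t⁻¹ = s * g * s⁻¹ := by
  have hy : g (s⁻¹ x) = s⁻¹ x := by
    rw [Equiv.Perm.eq_inv_iff_eq]
    exact hs
  have hcomm : g * Equiv.swap (s⁻¹ x) x = Equiv.swap (s⁻¹ x) x * g := by
    rw [Equiv.mul_swap_eq_swap_mul, hy, hg]
  have hfix : (s * Equiv.swap (s⁻¹ x) x) x = x := by
    simp
  have hconj : (s * Equiv.swap (s⁻¹ x) x) * g * (s * Equiv.swap (s⁻¹ x) x)⁻¹ = s * g * s⁻¹ := by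
    rw [mul_assoc s, ← hcomm]
    group
  exact ⟨hfix, hconj, _, hfix, hconj⟩
end

section
/- Let α be a finite type with decidable equality and x ∈ α, and let G₀ = {σ ∈ Perm(α) : σ(x) = x} be the stabilizer subgroup of x in G = Perm(α). Then (G, G₀) is an admissible pair. (For α = {1, …, n} and x = n this says that the pair (S_n, S_{n−1}) is admissible.) -/
/-- If a permutation `g` and its conjugate `s * g * s⁻¹` both fix `x`, then they are conjugate by a
permutation fixing `x`. -/
theorem Equiv.Perm.exists_mem_stabilizer_conj_eq {α : Type*} [DecidableEq α] {x : α}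
    {g s : Equiv.Perm α} (hg : g x = x) (hs : (s * g * s⁻¹) x = x) :
    ∃ t ∈ MulAction.stabilizer (Equiv.Perm α) x, t * g * t⁻¹ = s * g * s⁻¹ := by
  have hy : g (s⁻¹ x) = s⁻¹ x := by
    rw [Equiv.Perm.eq_inv_iff_eq]
    simpa only [Equiv.Perm.mul_apply] using hs
  have hcomm : g * Equiv.swap x (s⁻¹ x) = Equiv.swap x (s⁻¹ x) * g := by
    rw [Equiv.mul_swap_eq_swap_mul, hg, hy]
  refine ⟨s * Equiv.swap x (s⁻¹ x), ?_, ?_⟩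
  · simp [MulAction.mem_stabilizer_iff]
  · rw [mul_assoc s, ← hcomm]
    group

/-- For a finite type `α` and `x ∈ α`, the full permutation group of `α` together with the
stabilizer subgroup of `x` forms an admissible pair; for `α = Fin n` this says that
`(Sₙ, Sₙ₋₁)` is an admissible pair. -/
theorem isAdmissiblePair_perm_stabilizer {α : Type} [Fintype α] [DecidableEq α] (x : α) :
    IsAdmissiblePair (Equiv.Perm α) (MulAction.stabilizer (Equiv.Perm α) x) := by
  intro τ _ g s hg hs
  obtain ⟨t, ht, htg⟩ := Equiv.Perm.exists_mem_stabilizer_conj_eq hg hs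
  rw [← FDRep.char_conj τ ⟨g, hg⟩ ⟨t, ht⟩]
  congr 1
  exact Subtype.ext htg.symm
end

section
/- Let G be a finite group with subgroups G₀ ≤ G₁ ≤ G. If (G₁, G₀) is an admissible pair and (G, G₁) is an admissible pair, then (G, G₀) is an admissible pair. -/
open CategoryTheory Representation
open scoped MonoidAlgebra

/-- The representation attached to an irreducible representation of a finite group is a simple
object of the category of finite-dimensional representations. -/
theorem FDRep.simple_of_isIrreducible {k G V : Type} [Field k] [IsAlgClosed k] [CharZero k]
    [Group G] [Finite G] [AddCommGroup V] [Module k V] [FiniteDimensional k V]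
    (ρ : Representation k G V) [IsIrreducible ρ] : Simple (FDRep.of ρ) := by
  have := Fintype.ofFinite G
  have hG : (Nat.card G : k) ≠ 0 := NeZero.ne _
  have := invertibleOfNonzero hG
  have h := Representation.char_orthonormal ρ ρ
  rw [if_pos ⟨Representation.Equiv.refl ρ⟩] at h
  rw [FDRep.simple_iff_char_is_norm_one]
  change ∑ g : G, ρ.character g * ρ.character g⁻¹ = _
  exact (inv_mul_eq_one₀ hG).mp h |>.symm

/-- A central element of the group algebra that has trace zero on an irreducible representation
annihilates it. -/
theorem Representation.IsIrreducible.asAlgebraHom_eq_zero {k G V : Type*} [Field k]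
    [IsAlgClosed k] [CharZero k] [Group G] [AddCommGroup V] [Module k V] [FiniteDimensional k V]
    (ρ : Representation k G V) [IsIrreducible ρ] {z : k[G]}
    (hz : ∀ h : G, Commute (MonoidAlgebra.of k G h) z)
    (htr : LinearMap.trace k V (ρ.asAlgebraHom z) = 0) : ρ.asAlgebraHom z = 0 := by
  have hcomm (h : G) : ρ.asAlgebraHom z ∘ₗ ρ h = ρ h ∘ₗ ρ.asAlgebraHom z := by
    simpa [Module.End.mul_eq_comp] using ((hz h).map ρ.asAlgebraHom).eq.symm
  let f : IntertwiningMap ρ ρ := ⟨ρ.asAlgebraHom z, hcomm⟩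
  obtain ⟨c, hc⟩ := (algebraMap_intertwiningMap_bijective_of_isAlgClosed (ρ := ρ)).2 f
  have hf : ρ.asAlgebraHom z = c • LinearMap.id := by
    ext v
    exact congr($hc v).symm
  rw [hf, map_smul, LinearMap.trace_id, smul_eq_mul, mul_eq_zero, Nat.cast_eq_zero] at htr
  rcases htr with hc0 | hV
  · rw [hf, hc0, zero_smul]
  · have := Module.finrank_zero_iff.mp hV
    exact Subsingleton.elim _ _

/-- If an element of the group algebra of a finite group annihilates all irreducible
representations, then it annihilates all simple modules. -/
theorem MonoidAlgebra.smul_eq_zero_of_forall_isIrreducible {k G : Type} [Field k] [Group G]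
    [Finite G] {z : k[G]}
    (hz : ∀ (V : Type) [AddCommGroup V] [Module k V] [FiniteDimensional k V]
      (ρ : Representation k G V), IsIrreducible ρ → ρ.asAlgebraHom z = 0)
    {M : Type} [AddCommGroup M] [Module k[G] M] [IsSimpleModule k[G] M] (m : M) :
    z • m = 0 := by
  have hirr := (isSimpleModule_iff_irreducible_ofModule (k := k) (G := G) M).mp inferInstance
  let _ : Module k[G] (RestrictScalars k k[G] M) := RestrictScalars.moduleOrig k k[G] M
  have : IsScalarTower k k[G] (RestrictScalars k k[G] M) := RestrictScalars.isScalarTower k k[G] M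
  have : Module.Finite k[G] (RestrictScalars k k[G] M) :=
    inferInstanceAs (Module.Finite k[G] M)
  have : Module.Finite k (RestrictScalars k k[G] M) := .trans k[G] _
  have hzero : (ofModule (k := k) (G := G) M).asAlgebraHom z = 0 :=
    @hz _ _ (RestrictScalars.module k k[G] M) ‹_› (ofModule M) hirr
  exact (ofModule_asAlgebraHom_apply_apply (k := k) (G := G) M z
    ((RestrictScalars.addEquiv k k[G] M).symm m)).symm.trans (LinearMap.congr_fun hzero _)

/-- An element of the group algebra of a finite group annihilating all irreducible
representations is zero. -/
theorem MonoidAlgebra.eq_zero_of_forall_isIrreducible {k G : Type} [Field k] [CharZero k]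
    [Group G] [Finite G] {z : k[G]}
    (hz : ∀ (V : Type) [AddCommGroup V] [Module k V] [FiniteDimensional k V]
      (ρ : Representation k G V), IsIrreducible ρ → ρ.asAlgebraHom z = 0) : z = 0 := by
  have htop := IsSemisimpleModule.sSup_simples_eq_top k[G] k[G]
  have : ∀ m : k[G], z • m = 0 := by
    intro m
    have hm : m ∈ sSup {S : Submodule k[G] k[G] | IsSimpleModule k[G] S} := htop ▸ trivial
    rw [sSup_eq_iSup'] at hm
    induction hm using Submodule.iSup_induction' with
    | mem S m hm =>
      have : IsSimpleModule k[G] S.1 := S.2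
      exact congrArg Subtype.val (smul_eq_zero_of_forall_isIrreducible hz (⟨m, hm⟩ : S.1))
    | zero => exact smul_zero z
    | add x y _ _ hx hy => rw [smul_add, hx, hy, add_zero]
  simpa using this 1

/-- Elements of a finite group on which all irreducible characters agree are conjugate. -/
theorem isConj_of_forall_character_eq {k G : Type} [Field k] [IsAlgClosed k] [CharZero k]
    [Group G] [Finite G] {a b : G}
    (hab : ∀ (V : Type) [AddCommGroup V] [Module k V] [FiniteDimensional k V]
      (ρ : Representation k G V), IsIrreducible ρ → ρ.character a = ρ.character b) :
    IsConj a b := by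
  classical
  have := Fintype.ofFinite G
  let c (x : G) : k[G] := ∑ h : G, MonoidAlgebra.of k G (h * x * h⁻¹)
  have hc (x g : G) : Commute (MonoidAlgebra.of k G g) (c x) := by
    simp only [c, Commute, SemiconjBy, Finset.mul_sum, Finset.sum_mul, ← map_mul]
    exact Fintype.sum_equiv (Equiv.mulLeft g) _ _ fun h ↦ by simp [mul_assoc]
  have htr (V : Type) [AddCommGroup V] [Module k V] [FiniteDimensional k V]
      (ρ : Representation k G V) (x : G) :
      LinearMap.trace k V (ρ.asAlgebraHom (c x)) = Nat.card G * ρ.character x := by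
    have h (h : G) : LinearMap.trace k V (ρ (h * x * h⁻¹)) = ρ.character x := ρ.char_conj x h
    simp only [c, map_sum, asAlgebraHom_of, h]
    simp
  have hz : c a - c b = 0 := MonoidAlgebra.eq_zero_of_forall_isIrreducible fun V _ _ _ ρ hρ ↦
    hρ.asAlgebraHom_eq_zero ρ (fun h ↦ (hc a h).sub_right (hc b h)) <| by
      rw [map_sub, map_sub, htr, htr, hab V ρ hρ, sub_self]
  have hcoeff (x : G) : (c x).coeff b = (Finset.univ.filter fun h : G ↦ h * x * h⁻¹ = b).card := by
    simp [c, Finsupp.single_apply]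
  have hcard : (Finset.univ.filter fun h : G ↦ h * a * h⁻¹ = b).card =
      (Finset.univ.filter fun h : G ↦ h * b * h⁻¹ = b).card := by
    exact_mod_cast (hcoeff a).symm.trans ((congr(($(sub_eq_zero.mp hz)).coeff b)).trans (hcoeff b))
  have hpos : 0 < (Finset.univ.filter fun h : G ↦ h * b * h⁻¹ = b).card :=
    Finset.card_pos.mpr ⟨1, by simp⟩
  obtain ⟨h, hh⟩ := Finset.card_pos.mp (hcard ▸ hpos)
  exact isConj_iff.mpr ⟨h, by simpa using hh⟩

/-- Transitivity of admissibility: for subgroups `G₀ ≤ G₁ ≤ G`, if `(G₁, G₀)` and `(G, G₁)`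
are admissible pairs, then so is `(G, G₀)`. -/
theorem isAdmissiblePair_trans {G : Type} [Group G] [Finite G] (G₀ G₁ : Subgroup G)
    (hle : G₀ ≤ G₁) (h₁ : IsAdmissiblePair G₁ (G₀.subgroupOf G₁))
    (h₂ : IsAdmissiblePair G G₁) :
    IsAdmissiblePair G G₀ := by
  intro τ hτ g s hg hs
  have hconj : IsConj (⟨g, hle hg⟩ : G₁) ⟨s * g * s⁻¹, hle hs⟩ :=
    isConj_of_forall_character_eq (k := ℂ) fun V _ _ _ ρ hρ ↦
      (h₂ (FDRep.of ρ) (FDRep.simple_of_isIrreducible ρ) g s (hle hg) (hle hs)).symm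
  obtain ⟨t, ht⟩ := isConj_iff.mp hconj
  have ht' : (t : G) * g * (t : G)⁻¹ = s * g * s⁻¹ := congr(($ht : G))
  let e : G₀.subgroupOf G₁ ≃* G₀ := Subgroup.subgroupOfEquivOfLe hle
  let E := Action.resEquiv (FGModuleCat ℂ) e
  have hsimple : Simple (E.functor.obj τ) := simple_obj E.functor τ
  have h := h₁ (E.functor.obj τ) hsimple ⟨g, hle hg⟩ t hg (by
    rw [ht]; exact hs)
  have hτt : τ.character ⟨t * g * (t : G)⁻¹, ht' ▸ hs⟩ = τ.character ⟨g, hg⟩ := h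
  simpa only [ht'] using hτt
end

section
/- Let G be a finite group and G₀ a normal abelian subgroup of G. Then (G, G₀) is an admissible pair if and only if G₀ is contained in the center of G, i.e. s·g·s⁻¹ = g for every g ∈ G₀ and every s ∈ G. -/
/-- The one-dimensional representation attached to a linear character `φ : H →* ℂˣ`. -/
noncomputable def FDRep.ofLinearCharacter {H : Type} [Group H] (φ : H →* ℂˣ) : FDRep ℂ H :=
  FDRep.of (V := ℂ) ((Algebra.lmul ℂ ℂ).toMonoidHom.comp ((Units.coeHom ℂ).comp φ))

lemma FDRep.character_ofLinearCharacter {H : Type} [Group H] (φ : H →* ℂˣ) (h : H) :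
    (FDRep.ofLinearCharacter φ).character h = φ h := by
  change LinearMap.trace ℂ ℂ (Algebra.lmul ℂ ℂ (φ h : ℂ)) = φ h
  simp [LinearMap.trace_eq_matrix_trace ℂ (Module.Basis.singleton Unit ℂ), Matrix.trace,
    LinearMap.toMatrix_apply]

lemma FDRep.simple_ofLinearCharacter {H : Type} [Group H] [Finite H] (φ : H →* ℂˣ) :
    CategoryTheory.Simple (FDRep.ofLinearCharacter φ) := by
  have := Fintype.ofFinite H
  rw [FDRep.simple_iff_char_is_norm_one]
  simp [FDRep.character_ofLinearCharacter]

/-- For a normal *abelian* subgroup `G₀` of a finite group `G`, the pair `(G, G₀)` is admissible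
if and only if `G₀` is contained in the center of `G`, i.e. `s g s⁻¹ = g` for all `g ∈ G₀` and
`s ∈ G`. -/
theorem isAdmissiblePair_iff_central {G : Type} [Group G] [Finite G] (G₀ : Subgroup G)
    [G₀.Normal] (hcomm : ∀ a b : G₀, a * b = b * a) :
    IsAdmissiblePair G G₀ ↔ ∀ g ∈ G₀, ∀ s : G, s * g * s⁻¹ = g := by
  constructor
  · intro h g hg s
    have hs : s * g * s⁻¹ ∈ G₀ := Subgroup.Normal.conj_mem ‹_› g hg s
    let _ : CommGroup G₀ := { (inferInstance : Group G₀) with mul_comm := hcomm }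
    have key : (⟨s * g * s⁻¹, hs⟩ : G₀) = ⟨g, hg⟩ := by
      refine (CommGroup.forall_apply_eq_apply_iff G₀ (M := ℂ)).mp fun φ ↦ Units.ext ?_
      simpa only [FDRep.character_ofLinearCharacter] using
        h (FDRep.ofLinearCharacter φ) (FDRep.simple_ofLinearCharacter φ) g s hg hs
    exact congrArg Subtype.val key
  · intro h τ _ g s hg hs
    exact congrArg τ.character (Subtype.ext (h g hg s))
end

section
/- Let H be a finite abelian group, G₀ a finite group, φ : G₀ → Aut(H) a group action, and G = H ⋊_φ G₀ the semidirect product, with H identified with the normal subgroup {(h, 1) : h ∈ H} of G via the canonical inclusion. Then (G, H) is an admissible pair if and only if the action φ is trivial, i.e. φ(g) is the identity automorphism of H for every g ∈ G₀. -/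
/-- The one-dimensional representation on `k` attached to a linear character. -/
noncomputable def linearCharacterRep {k G : Type*} [Field k] [Group G] (χ : G →* kˣ) :
    Representation k G k :=
  (Algebra.lmul k k).toMonoidHom.comp ((Units.coeHom k).comp χ)

theorem character_linearCharacterRep {k G : Type*} [Field k] [Group G] (χ : G →* kˣ) (g : G) :
    (FDRep.of (linearCharacterRep χ)).character g = χ g := by
  change LinearMap.trace k k (Algebra.lmul k k (χ g : k)) = χ g
  rw [← Algebra.trace_apply, Algebra.trace_self_apply]

theorem simple_linearCharacterRep {k G : Type} [Field k] [IsAlgClosed k] [CharZero k] [Group G]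
    [Finite G] (χ : G →* kˣ) : CategoryTheory.Simple (FDRep.of (linearCharacterRep χ)) := by
  have := Fintype.ofFinite G
  rw [FDRep.simple_iff_char_is_norm_one]
  simp [character_linearCharacterRep]

/-- Let `H` be a finite abelian group, `G₀` a finite group, `φ : G₀ →* Aut H` an action and
`G = H ⋊[φ] G₀`, with `H` identified with the normal subgroup `{(h, 1)}` of `G`. Then `(G, H)`
is an admissible pair if and only if the action `φ` is trivial. -/
theorem isAdmissiblePair_semidirect_iff_trivial_action {H G₀ : Type} [CommGroup H] [Finite H]
    [Group G₀] [Finite G₀] (φ : G₀ →* MulAut H) :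
    IsAdmissiblePair (H ⋊[φ] G₀) (SemidirectProduct.inl : H →* H ⋊[φ] G₀).range ↔
      ∀ g : G₀, φ g = 1 := by
  constructor
  · intro hadm g
    by_contra hg
    obtain ⟨h, hh⟩ : ∃ h, φ g h ≠ h := by
      by_contra! hfix
      exact hg (MulEquiv.ext hfix)
    let e := MonoidHom.ofInjective (SemidirectProduct.inl_injective (φ := φ))
    obtain ⟨χ, hχ⟩ := CommGroup.exists_apply_ne_one_of_hasEnoughRootsOfUnity H ℂ
      (a := φ g h / h) (div_ne_one.mpr hh)
    have : Finite (SemidirectProduct.inl : H →* H ⋊[φ] G₀).range := Finite.of_equiv H e.toEquiv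
    have hconj : (SemidirectProduct.inr g : H ⋊[φ] G₀) * SemidirectProduct.inl h *
        (SemidirectProduct.inr g)⁻¹ = SemidirectProduct.inl (φ g h) := by
      rw [SemidirectProduct.inl_aut, map_inv]
    have hmem (x : H) : (SemidirectProduct.inl x : H ⋊[φ] G₀) ∈
        (SemidirectProduct.inl : H →* H ⋊[φ] G₀).range := ⟨x, rfl⟩
    have hsymm (x : H) : e.symm ⟨SemidirectProduct.inl x, hmem x⟩ = x := e.symm_apply_apply x
    have key := hadm _ (simple_linearCharacterRep (χ.comp e.symm.toMonoidHom))
      (SemidirectProduct.inl h) (SemidirectProduct.inr g) (hmem h) (hconj ▸ hmem _)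
    simp only [hconj, character_linearCharacterRep, MonoidHom.comp_apply,
      MulEquiv.toMonoidHom_eq_coe, MonoidHom.coe_coe, hsymm, Units.val_inj] at key
    exact hχ (by rw [map_div, key, div_self'])
  · rintro htriv τ - _ s ⟨h, rfl⟩ hs
    have hcomm : s * SemidirectProduct.inl h * s⁻¹ = SemidirectProduct.inl h := by
      rw [mul_inv_eq_iff_eq_mul]
      ext <;> simp [htriv, mul_comm]
    simp only [hcomm]
end
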